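/- arXiv:2603.05416 — 2 statements merged into one kernel-verified Lean document; each statement's English description precedes it below -/
import Mathlib

section
/- Let φ be a bijection of the set 𝒜 of point-hyperplane anti-flags of PG(n-1,F) such that for all anti-flags A, B: A ~_3 B if and only if φ(A) ~_3 φ(B). Then either (i) there exist a field automorphism σ of F and a σ-semilinear bijection g : V → V such that φ(p, H) = (g(p), g(H)) for every anti-flag (p, H), where g(X) denotes the image of the subspace X under g, or (ii) there exist a field automorphism σ of F and a σ-semilinear bijection u : V → V* such that φ(p, H) = (u(H)^0, u(p)^0) for every anti-flag (p, H), where for a subspace X ⊆ V* the annihilator X^0 is the subspace {x ∈ V : f(x) = 0 for all f ∈ X}. -/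
/-- A point-hyperplane anti-flag of `PG(n-1,F)`: a pair `(p, H)` where `p` is a point
(1-dimensional subspace of `F^n`), `H` is a hyperplane ((n-1)-dimensional subspace),
and `p` is not contained in `H`. -/
structure AntiFlag (F : Type*) [Field F] (n : ℕ) where
  pt : Submodule F (Fin n → F)
  hyp : Submodule F (Fin n → F)
  pt_rank : Module.finrank F pt = 1
  hyp_rank : Module.finrank F hyp = n - 1
  not_incident : ¬ pt ≤ hyp

variable {F : Type*} [Field F] {n : ℕ}

/-- `A ~₁ B` : for some `j`, `p_j ⊆ H_{3-j}` and `p_{3-j} ⊄ H_j`. -/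
def adj1 (A B : AntiFlag F n) : Prop :=
  A ≠ B ∧ ((A.pt ≤ B.hyp ∧ ¬ B.pt ≤ A.hyp) ∨ (B.pt ≤ A.hyp ∧ ¬ A.pt ≤ B.hyp))

/-- `A ~₂ B` : `p_1 ⊆ H_2` and `p_2 ⊆ H_1`. -/
def adj2 (A B : AntiFlag F n) : Prop :=
  A ≠ B ∧ A.pt ≤ B.hyp ∧ B.pt ≤ A.hyp

/-- `A ~₃ B` : `p_1 = p_2` or `H_1 = H_2`. -/
def adj3 (A B : AntiFlag F n) : Prop :=
  A ≠ B ∧ (A.pt = B.pt ∨ A.hyp = B.hyp)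

/-- `A ~₄ B` : `p_1 ≠ p_2`, `H_1 ≠ H_2`, `p_1 ⊄ H_2` and `p_2 ⊄ H_1`. -/
def adj4 (A B : AntiFlag F n) : Prop :=
  A ≠ B ∧ A.pt ≠ B.pt ∧ A.hyp ≠ B.hyp ∧ ¬ A.pt ≤ B.hyp ∧ ¬ B.pt ≤ A.hyp

/-- `𝒳^{~ᵢ}` : the set of anti-flags `i`-adjacent to every anti-flag of `𝒳`. -/
def perpSet (adj : AntiFlag F n → AntiFlag F n → Prop) (X : Set (AntiFlag F n)) :
    Set (AntiFlag F n) := {B | ∀ A ∈ X, adj A B}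

/-- A map of coordinate vectors which preserves the coordinate hyperplanes and the all-ones vector,
and maps hyperplanes to hyperplanes, agrees up to scalars with the coordinatewise application of a
field automorphism. -/
theorem exists_ringEquiv_smul_comp {K ι : Type*} [Field K] [Fintype ι] [DecidableEq ι]
    (hι : 2 < Fintype.card ι) (f : (ι → K) → ι → K)
    (h0 : ∀ i x, x i = 0 ↔ f x i = 0) (h1 : ∀ i, f 1 i = 1)
    (hP : ∀ ξ : ι → K, ∃ η : ι → K, ∀ x, ξ ⬝ᵥ x = 0 ↔ η ⬝ᵥ f x = 0)
    (hs : ∀ y, ∃ x, ∃ c : K, y = c • f x) :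
    ∃ σ : K ≃+* K, ∀ x, ∃ c : K, c ≠ 0 ∧ f x = c • (fun i => σ (x i)) := by
  have supp : ∀ ξ η : ι → K, (∀ x, ξ ⬝ᵥ x = 0 ↔ η ⬝ᵥ f x = 0) → ∀ l, ξ l = 0 ↔ η l = 0 := by
    intro ξ η h l
    have hx := h (Pi.single l 1)
    have hz : ∀ m, m ≠ l → f (Pi.single l 1) m = 0 := fun m hm =>
      (h0 m _).1 (by simp [hm])
    have hl : f (Pi.single l 1) l ≠ 0 := fun h => by simpa using (h0 l _).2 h
    have he : η ⬝ᵥ f (Pi.single l 1) = η l * f (Pi.single l 1) l :=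
      Finset.sum_eq_single l (fun m _ hm => by simp [hz m hm]) (by simp)
    rw [he] at hx
    simpa [hl] using hx
  have ratio : ∀ i j (a : K), ∃ s : K, i ≠ j → ∀ x, x i = a * x j → f x i = s * f x j := by
    intro i j a
    by_cases hij : i = j
    · exact ⟨0, fun h => absurd hij h⟩
    obtain ⟨η, hη⟩ := hP (Pi.single i 1 - Pi.single j a)
    have hsu := supp _ _ hη
    have hi : η i ≠ 0 := fun h => by simpa [hij] using (hsu i).2 h
    have hform : ∀ y, η ⬝ᵥ y = η i * y i + η j * y j := fun y =>
      Finset.sum_eq_add i j hij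
        (fun m _ hm => by rw [(hsu m).1 (by simp [hm.1, hm.2]), zero_mul]) (by simp) (by simp)
    refine ⟨-(η j / η i), fun _ x hx => ?_⟩
    have := (hη x).1 (by simp [sub_dotProduct, hx])
    rw [hform] at this
    field_simp
    linear_combination this
  choose τ hτ using ratio
  have τ_mul : ∀ i j k, i ≠ j → j ≠ k → i ≠ k → ∀ a c, τ i k (a * c) = τ i j a * τ j k c := by
    intro i j k hij hjk hik a c
    let x : ι → K := fun l => if l = i then a * c else if l = j then c else 1
    have xi : x i = a * c := by simp [x]
    have xj : x j = c := by simp [x, hij.symm]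
    have xk : x k = 1 := by simp [x, hik.symm, hjk.symm]
    have hk : f x k ≠ 0 := fun h => by simpa [xk] using (h0 k x).2 h
    have e1 := hτ i j a hij x (by rw [xi, xj])
    have e2 := hτ j k c hjk x (by rw [xj, xk, mul_one])
    have e3 := hτ i k (a * c) hik x (by rw [xi, xk, mul_one])
    apply mul_right_cancel₀ hk
    rw [← e3, e1, e2, mul_assoc]
  have τ_one : ∀ i j, i ≠ j → τ i j 1 = 1 := by
    intro i j hij
    simpa [h1] using (hτ i j 1 hij 1 (by simp)).symm
  have third : ∀ i j : ι, ∃ k, i ≠ k ∧ j ≠ k := by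
    intro i j
    obtain ⟨k, -, hk⟩ := Finset.exists_mem_notMem_of_card_lt_card
      (s := {i, j}) (t := Finset.univ) (lt_of_le_of_lt Finset.card_le_two hι)
    simp only [Finset.mem_insert, Finset.mem_singleton, not_or] at hk
    exact ⟨k, Ne.symm hk.1, Ne.symm hk.2⟩
  have left : ∀ i j k, i ≠ k → j ≠ k → τ i k = τ j k := by
    intro i j k hik hjk
    by_cases hij : i = j
    · rw [hij]
    funext c
    simpa [τ_one i j hij] using τ_mul i j k hij hjk hik 1 c
  have right : ∀ i j k, i ≠ j → i ≠ k → τ i j = τ i k := by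
    intro i j k hij hik
    by_cases hjk : j = k
    · rw [hjk]
    funext a
    simpa [τ_one j k hjk] using (τ_mul i j k hij hjk hik a 1).symm
  have flip : ∀ i j, i ≠ j → τ i j = τ j i := by
    intro i j hij
    obtain ⟨k, hik, hjk⟩ := third i j
    rw [left i k j hij hjk.symm, right k j i hjk.symm hik.symm, left k j i hik.symm hij.symm]
  obtain ⟨p, q, r, hpq, hpr, hqr⟩ := Fintype.two_lt_card_iff.1 hι
  have all : ∀ i j, i ≠ j → τ i j = τ p q := by
    intro i j hij
    by_cases hiq : i = q
    · subst hiq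
      rw [flip i j hij, left j p i hij.symm hpq]
    · rw [right i j q hij hiq, left i p q hiq hpq]
  have σ_mul : ∀ a c, τ p q (a * c) = τ p q a * τ p q c := by
    intro a c
    have := τ_mul p r q hpr hqr.symm hpq a c
    rwa [all p r hpr, all r q hqr.symm] at this
  have hσ : ∀ a i j, i ≠ j → ∀ x, x i = a * x j → f x i = τ p q a * f x j :=
    fun a i j hij => all i j hij ▸ hτ i j a hij
  have σ_zero : τ p q 0 = 0 := by
    have h := hσ 0 p q hpq (Pi.single q 1) (by simp [hpq])
    rw [(h0 p _).1 (by simp [hpq])] at h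
    have hq : f (Pi.single q 1) q ≠ 0 := fun h => by simpa using (h0 q _).2 h
    simpa [hq] using h.symm
  have σ_one : τ p q 1 = 1 := τ_one p q hpq
  have eq_of_eq : ∀ i j, i ≠ j → ∀ x, x i = x j → f x i = f x j := by
    intro i j hij x hx
    simpa [σ_one] using hσ 1 i j hij x (by simpa using hx)
  have σ_succ : ∀ a, τ p q (a + 1) = τ p q a + 1 := by
    intro a
    obtain ⟨η, hη⟩ := hP (Pi.single p 1 - Pi.single r 1 - Pi.single q 1)
    have hsu := supp _ _ hη
    have hp : η p ≠ 0 := fun h => by simpa [hpr, hpq] using (hsu p).2 h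
    have hform : ∀ y, η ⬝ᵥ y = η p * y p + η q * y q + η r * y r := by
      intro y
      have hη' : η = Pi.single p (η p) + Pi.single q (η q) + Pi.single r (η r) := by
        funext m
        by_cases h1 : m = p
        · subst h1; simp [hpr, hpq]
        by_cases h2 : m = q
        · subst h2; simp [hqr, h1]
        by_cases h3 : m = r
        · subst h3; simp [h1, h2]
        · simp [h1, h2, h3, (hsu m).1]
      conv_lhs => rw [hη']
      simp [add_dotProduct]
    have coef : ∀ k, (k = q ∨ k = r) → η k = - η p := by
      intro k hk
      let x : ι → K := Pi.single p 1 + Pi.single k 1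
      have hpk : p ≠ k := by rcases hk with rfl | rfl <;> assumption
      have xp : x p = 1 := by simp [x, hpk]
      have xk : x k = 1 := by simp [x, hpk.symm]
      have hfp : f x p ≠ 0 := fun h => by simpa [xp] using (h0 p x).2 h
      have e := eq_of_eq p k hpk x (by rw [xp, xk])
      have hx := (hη x).1 (by
        rcases hk with rfl | rfl <;> simp [x, hpk, hpk.symm, hpq, hpr, hqr, hqr.symm])
      rw [hform] at hx
      apply mul_right_cancel₀ hfp
      rcases hk with rfl | rfl
      · rw [(h0 r x).1 (by simp [x, hpr.symm, hqr.symm]), ← e] at hx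
        linear_combination hx
      · rw [(h0 q x).1 (by simp [x, hpq.symm, hqr]), ← e] at hx
        linear_combination hx
    let x : ι → K := fun l => if l = p then a + 1 else if l = r then a else 1
    have xp : x p = a + 1 := by simp [x]
    have xr : x r = a := by simp [x, hpr.symm]
    have xq : x q = 1 := by simp [x, hpq.symm, hqr]
    have hq : f x q ≠ 0 := fun h => by simpa [xq] using (h0 q x).2 h
    have e1 := hσ (a + 1) p q hpq x (by rw [xp, xq, mul_one])
    have e2 := hσ a r q hqr.symm x (by rw [xr, xq, mul_one])
    have hx := (hη x).1 (by simp [sub_dotProduct, xp, xr, xq])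
    rw [hform, coef q (Or.inl rfl), coef r (Or.inr rfl), e1, e2] at hx
    apply mul_right_cancel₀ hq
    apply mul_left_cancel₀ hp
    linear_combination hx
  have σ_add : ∀ a c, τ p q (a + c) = τ p q a + τ p q c := by
    intro a c
    by_cases hc : c = 0
    · simp [hc, σ_zero]
    have e : a + c = c * (a / c + 1) := by field_simp
    rw [e, σ_mul, σ_succ, mul_add, ← σ_mul, mul_div_cancel₀ _ hc, mul_one]
  let s : K →+* K :=
    { toFun := τ p q, map_one' := σ_one, map_mul' := σ_mul, map_zero' := σ_zero, map_add' := σ_add }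
  have s_surj : Function.Surjective s := by
    intro t
    obtain ⟨x, c, hx⟩ := hs (Pi.single p t + Pi.single q 1)
    have hp : t = c * f x p := by simpa [hpq] using congrFun hx p
    have hq : 1 = c * f x q := by simpa [hpq.symm] using congrFun hx q
    have hxq : x q ≠ 0 := fun h => by simp [(h0 q x).1 h] at hq
    refine ⟨x p / x q, ?_⟩
    have e := hσ (x p / x q) p q hpq x (by field_simp)
    change τ p q _ = t
    rw [hp, e]
    linear_combination τ p q (x p / x q) * hq
  suffices ∀ x, ∃ c : K, c ≠ 0 ∧ f x = c • fun i => s (x i) from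
    ⟨RingEquiv.ofBijective s ⟨s.injective, s_surj⟩, this⟩
  intro x
  by_cases hx : ∃ j, x j ≠ 0
  · obtain ⟨j, hj⟩ := hx
    have hfj : f x j ≠ 0 := fun h => hj ((h0 j x).2 h)
    have hsj : s (x j) ≠ 0 := by simpa using hj
    refine ⟨f x j / s (x j), div_ne_zero hfj hsj, funext fun i => ?_⟩
    simp only [Pi.smul_apply, smul_eq_mul]
    by_cases hij : i = j
    · subst hij
      field_simp
    · have e : f x i = s (x i / x j) * f x j := hσ (x i / x j) i j hij x (by field_simp)
      rw [e, map_div₀]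
      field_simp
  · push Not at hx
    refine ⟨1, one_ne_zero, funext fun i => ?_⟩
    simp [hx i, (h0 i x).1 (hx i)]

/-- A form of the fundamental theorem of projective geometry, for maps of vectors respecting
hyperplanes. -/
theorem exists_semilinear_of_map_hyperplanes {K W : Type*} [Field K] [AddCommGroup W] [Module K W]
    [FiniteDimensional K W] {m : ℕ} (hm : 3 ≤ m) (hW : Module.finrank K W = m)
    (f : (Fin m → K) → W) (hf : f 0 = 0)
    (hP : ∀ ξ : Module.Dual K (Fin m → K), ∃ η : Module.Dual K W, ∀ x, ξ x = 0 ↔ η (f x) = 0)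
    (hs : ∀ y, ∃ x, ∃ c : K, y = c • f x) :
    ∃ σ : K ≃+* K, ∃ g : (Fin m → K) → W, Function.Bijective g ∧ (∀ x y, g (x + y) = g x + g y) ∧
      (∀ (a : K) x, g (a • x) = σ a • g x) ∧ ∀ x, ∃ c : K, c ≠ 0 ∧ f x = c • g x := by
  choose η hη using fun i => hP (LinearMap.proj i)
  simp only [LinearMap.proj_apply] at hη
  have h1 : ∀ i, η i (f 1) ≠ 0 := fun i h => by simpa using (hη i 1).2 h
  let L₀ : W →ₗ[K] (Fin m → K) := LinearMap.pi fun i => (η i (f 1))⁻¹ • η i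
  have hL₀ : ∀ y i, L₀ y i = (η i (f 1))⁻¹ * η i y := fun y i => rfl
  have hinj : Function.Injective L₀ := by
    rw [← LinearMap.ker_eq_bot, LinearMap.ker_eq_bot']
    intro y hy
    obtain ⟨x, c, rfl⟩ := hs y
    by_cases hc : c = 0
    · simp [hc]
    have : x = 0 := funext fun i => (hη i x).2 (by
      have := congrFun hy i
      simpa [hL₀, h1, hc] using this)
    simp [this, hf]
  let L : W ≃ₗ[K] (Fin m → K) := LinearMap.linearEquivOfInjective L₀ hinj (by simp [hW])
  have hL : ∀ y i, L y i = (η i (f 1))⁻¹ * η i y := fun y i => rfl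
  obtain ⟨σ, hσ⟩ := exists_ringEquiv_smul_comp (by rw [Fintype.card_fin]; exact hm : 2 < Fintype.card (Fin m)) (fun x => L (f x))
    (fun i x => by rw [hη i x, hL]; simp [h1 i])
    (fun i => by rw [hL]; exact inv_mul_cancel₀ (h1 i))
    (fun ξ => by
      obtain ⟨ζ, hζ⟩ := hP (dotProductEquiv K (Fin m) ξ)
      refine ⟨fun i => ζ (L.symm (Pi.single i 1)), fun x => (hζ x).trans ?_⟩
      have : ζ (f x) = (fun i => ζ (L.symm (Pi.single i 1))) ⬝ᵥ L (f x) := by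
        conv_lhs => rw [← L.symm_apply_apply (f x), pi_eq_sum_univ' (L (f x))]
        simp [dotProduct, mul_comm]
      rw [this])
    (fun y => by
      obtain ⟨x, c, h⟩ := hs (L.symm y)
      exact ⟨x, c, by rw [← map_smul, ← h, L.apply_symm_apply]⟩)
  refine ⟨σ, fun x => L.symm fun i => σ (x i), ?_, fun x y => ?_, fun a x => ?_, fun x => ?_⟩
  · refine L.symm.bijective.comp ⟨fun x y h => funext fun i => σ.injective (congrFun h i),
      fun y => ⟨fun i => σ.symm (y i), by simp⟩⟩
  · rw [← map_add]
    exact congrArg L.symm (funext fun i => by simp)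
  · rw [← map_smul]
    exact congrArg L.symm (funext fun i => by simp)
  · obtain ⟨c, hc, h⟩ := hσ x
    exact ⟨c, hc, by rw [← map_smul, ← h, L.symm_apply_apply]⟩

namespace AntiFlag

open Submodule

/-- The anti-flag given by a vector spanning the point and a functional defining the hyperplane. -/
def ofVector (x : Fin n → F) (ξ : Module.Dual F (Fin n → F)) (h : ξ x ≠ 0) : AntiFlag F n where
  pt := span F {x}
  hyp := LinearMap.ker ξ
  pt_rank := finrank_span_singleton fun hx => h (by rw [hx, map_zero])
  hyp_rank := by
    have := Module.Dual.finrank_ker_add_one_of_ne_zero (f := ξ) fun hξ => h (by simp [hξ])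
    rw [Module.finrank_fin_fun] at this
    omega
  not_incident h' := h (h' (mem_span_singleton_self x))

theorem eq_of_pt_hyp {A B : AntiFlag F n} (h₁ : A.pt = B.pt) (h₂ : A.hyp = B.hyp) : A = B := by
  cases A; cases B; simp_all

theorem hyp_eq_of_le {A B : AntiFlag F n} (h : A.hyp ≤ B.hyp) : A.hyp = B.hyp :=
  eq_of_le_of_finrank_eq h (by rw [A.hyp_rank, B.hyp_rank])

theorem mem_pt_iff {A : AntiFlag F n} {x : Fin n → F} (hx : x ≠ 0) :
    x ∈ A.pt ↔ A.pt = span F {x} := by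
  refine ⟨fun h => (eq_of_le_of_finrank_eq ?_ ?_).symm, fun h => h ▸ mem_span_singleton_self x⟩
  · rwa [span_singleton_le_iff_mem]
  · rw [A.pt_rank, finrank_span_singleton hx]

theorem exists_eq_span_ker (A : AntiFlag F n) :
    ∃ x : Fin n → F, ∃ ξ : Module.Dual F (Fin n → F),
      ξ x ≠ 0 ∧ A.pt = span F {x} ∧ A.hyp = LinearMap.ker ξ := by
  obtain ⟨x, hx, hxA⟩ := SetLike.not_le_iff_exists.1 A.not_incident
  obtain ⟨ξ, hξ, hle⟩ := exists_le_ker_of_notMem hxA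
  have hx0 : x ≠ 0 := fun h => hxA (h ▸ zero_mem _)
  exact ⟨x, ξ, hξ, (mem_pt_iff hx0).1 hx, hyp_eq_of_le (B := ofVector x ξ hξ) hle⟩

theorem exists_pt_eq {x : Fin n → F} (hx : x ≠ 0) : ∃ A : AntiFlag F n, A.pt = span F {x} := by
  obtain ⟨ξ, hξ⟩ := Module.Projective.exists_dual_ne_zero F hx
  exact ⟨ofVector x ξ hξ, rfl⟩

theorem exists_hyp_eq {ξ : Module.Dual F (Fin n → F)} (hξ : ξ ≠ 0) :
    ∃ A : AntiFlag F n, A.hyp = LinearMap.ker ξ := by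
  obtain ⟨x, hx⟩ := DFunLike.ne_iff.1 hξ
  exact ⟨ofVector x ξ hx, rfl⟩

theorem not_pt_le_hyp_iff (A B : AntiFlag F n) :
    ¬ A.pt ≤ B.hyp ↔ ∃ C : AntiFlag F n, C.pt = A.pt ∧ C.hyp = B.hyp :=
  ⟨fun h => ⟨⟨A.pt, B.hyp, A.pt_rank, B.hyp_rank, h⟩, rfl, rfl⟩,
    fun ⟨C, h₁, h₂⟩ => h₁ ▸ h₂ ▸ C.not_incident⟩

theorem exists_dual_ne_zero₂ {x y : Fin n → F} (hx : x ≠ 0) (hy : y ≠ 0) :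
    ∃ ξ : Module.Dual F (Fin n → F), ξ x ≠ 0 ∧ ξ y ≠ 0 := by
  obtain ⟨ξ, hξ⟩ := Module.Projective.exists_dual_ne_zero F hx
  obtain ⟨ζ, hζ⟩ := Module.Projective.exists_dual_ne_zero F hy
  by_cases h₁ : ξ y = 0
  · by_cases h₂ : ζ x = 0
    · exact ⟨ξ + ζ, by simpa [h₂], by simpa [h₁]⟩
    · exact ⟨ζ, h₂, hζ⟩
  · exact ⟨ξ, hξ, h₁⟩

theorem exists_ne_pt_eq_and_hyp_eq (hn : 3 ≤ n) (A : AntiFlag F n) :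
    (∃ B, A ≠ B ∧ A.pt = B.pt) ∧ ∃ C, A ≠ C ∧ A.hyp = C.hyp := by
  obtain ⟨x, ξ, hξ, hpt, hhyp⟩ := A.exists_eq_span_ker
  have hx : x ≠ 0 := fun h => hξ (by simp [h])
  obtain ⟨y, hyA, hy⟩ : ∃ y ∈ A.hyp, y ≠ 0 := by
    refine exists_mem_ne_zero_of_ne_bot fun h => ?_
    have := A.hyp_rank
    rw [h, finrank_bot] at this
    omega
  have hξy : ξ y = 0 := by rwa [hhyp] at hyA
  obtain ⟨ζ, hζx, hζy⟩ := exists_dual_ne_zero₂ hx hy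
  refine ⟨⟨ofVector x ζ hζx, fun h => hζy ?_, hpt⟩,
    ⟨ofVector (x + y) ξ (by simpa [hξy]), fun h => A.not_incident ?_, hhyp⟩⟩
  · rw [h] at hyA
    exact hyA
  · have hxy : x + y ∈ A.pt := by
      rw [h]
      exact mem_span_singleton_self _
    have hxA : x ∈ A.pt := hpt ▸ mem_span_singleton_self x
    have hyp : y ∈ A.pt := by simpa using sub_mem hxy hxA
    rw [(mem_pt_iff hy).1 hyp, span_singleton_le_iff_mem]
    exact hyA

theorem exists_hyp_eq_of_pts (A B : AntiFlag F n) :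
    ∃ C D : AntiFlag F n, A.pt = C.pt ∧ C.hyp = D.hyp ∧ D.pt = B.pt := by
  obtain ⟨x, ξ, hx, hA, -⟩ := A.exists_eq_span_ker
  obtain ⟨y, η, hy, hB, -⟩ := B.exists_eq_span_ker
  obtain ⟨ζ, hζx, hζy⟩ := exists_dual_ne_zero₂ (x := x) (y := y)
    (fun h => hx (by simp [h])) (fun h => hy (by simp [h]))
  exact ⟨ofVector x ζ hζx, ofVector y ζ hζy, hA, rfl, hB.symm⟩

/-- `φ` maps the anti-flags sharing the point (the hyperplane) of `A` to anti-flags sharing the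
point (the hyperplane) of `φ A`. -/
def PreservesTypeAt (φ : AntiFlag F n ≃ AntiFlag F n) (A : AntiFlag F n) : Prop :=
  (∀ B, A.pt = B.pt → (φ A).pt = (φ B).pt) ∧ ∀ B, A.hyp = B.hyp → (φ A).hyp = (φ B).hyp

/-- `φ` maps the anti-flags sharing the point (the hyperplane) of `A` to anti-flags sharing the
hyperplane (the point) of `φ A`. -/
def SwapsTypeAt (φ : AntiFlag F n ≃ AntiFlag F n) (A : AntiFlag F n) : Prop :=
  (∀ B, A.pt = B.pt → (φ A).hyp = (φ B).hyp) ∧ ∀ B, A.hyp = B.hyp → (φ A).pt = (φ B).pt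

theorem preservesTypeAt_or_swapsTypeAt {φ : AntiFlag F n ≃ AntiFlag F n}
    (hφ : ∀ A B : AntiFlag F n, adj3 A B ↔ adj3 (φ A) (φ B)) (hn : 3 ≤ n) (A : AntiFlag F n) :
    PreservesTypeAt φ A ∨ SwapsTypeAt φ A := by
  have key : ∀ B C, A ≠ B → A.pt = B.pt → A ≠ C → A.hyp = C.hyp →
      ((φ A).pt = (φ B).pt ∧ (φ A).hyp = (φ C).hyp) ∨
      ((φ A).hyp = (φ B).hyp ∧ (φ A).pt = (φ C).pt) := by
    intro B C hAB hB hAC hC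
    have hBC : B ≠ C := by
      rintro rfl
      exact hAB (eq_of_pt_hyp hB hC)
    have hnot : ¬ adj3 (φ B) (φ C) := by
      rw [← hφ]
      rintro ⟨-, h | h⟩
      · exact hAC (eq_of_pt_hyp (hB.trans h) hC)
      · exact hAB (eq_of_pt_hyp hB (hC.trans h.symm))
    have h₁ := ((hφ A B).1 ⟨hAB, Or.inl hB⟩).2
    have h₂ := ((hφ A C).1 ⟨hAC, Or.inr hC⟩).2
    have hne : φ B ≠ φ C := φ.injective.ne hBC
    rcases h₁ with h₁ | h₁ <;> rcases h₂ with h₂ | h₂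
    · exact absurd ⟨hne, Or.inl (h₁.symm.trans h₂)⟩ hnot
    · exact Or.inl ⟨h₁, h₂⟩
    · exact Or.inr ⟨h₁, h₂⟩
    · exact absurd ⟨hne, Or.inr (h₁.symm.trans h₂)⟩ hnot
  have indep : ∀ B, A ≠ B → ¬ ((φ A).pt = (φ B).pt ∧ (φ A).hyp = (φ B).hyp) :=
    fun B h h' => h (φ.injective (eq_of_pt_hyp h'.1 h'.2))
  obtain ⟨⟨B, hAB, hB⟩, C, hAC, hC⟩ := exists_ne_pt_eq_and_hyp_eq hn A
  rcases key B C hAB hB hAC hC with ⟨h₁, h₂⟩ | ⟨h₁, h₂⟩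
  · refine Or.inl ⟨fun B' hB' => ?_, fun C' hC' => ?_⟩
    · by_cases h : A = B'
      · rw [h]
      rcases key B' C h hB' hAC hC with h' | h'
      · exact h'.1
      · exact absurd ⟨h'.2, h₂⟩ (indep C hAC)
    · by_cases h : A = C'
      · rw [h]
      rcases key B C' hAB hB h hC' with h' | h'
      · exact h'.2
      · exact absurd ⟨h₁, h'.1⟩ (indep B hAB)
  · refine Or.inr ⟨fun B' hB' => ?_, fun C' hC' => ?_⟩
    · by_cases h : A = B'
      · rw [h]
      rcases key B' C h hB' hAC hC with h' | h'
      · exact absurd ⟨h₂, h'.2⟩ (indep C hAC)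
      · exact h'.1
    · by_cases h : A = C'
      · rw [h]
      rcases key B C' hAB hB h hC' with h' | h'
      · exact absurd ⟨h'.1, h₁⟩ (indep B hAB)
      · exact h'.2

theorem PreservesTypeAt.of_pt_eq_or_hyp_eq {φ : AntiFlag F n ≃ AntiFlag F n}
    (hφ : ∀ A B : AntiFlag F n, adj3 A B ↔ adj3 (φ A) (φ B)) (hn : 3 ≤ n) {A B : AntiFlag F n}
    (hA : PreservesTypeAt φ A) (h : A.pt = B.pt ∨ A.hyp = B.hyp) : PreservesTypeAt φ B := by
  by_cases hAB : A = B
  · rwa [← hAB]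
  refine (preservesTypeAt_or_swapsTypeAt hφ hn B).resolve_right fun hB => hAB (φ.injective ?_)
  rcases h with h | h
  · exact eq_of_pt_hyp (hA.1 B h) (hB.1 A h.symm).symm
  · exact eq_of_pt_hyp (hB.2 A h.symm).symm (hA.2 B h)

theorem forall_preservesTypeAt_or_forall_swapsTypeAt {φ : AntiFlag F n ≃ AntiFlag F n}
    (hφ : ∀ A B : AntiFlag F n, adj3 A B ↔ adj3 (φ A) (φ B)) (hn : 3 ≤ n) :
    (∀ A, PreservesTypeAt φ A) ∨ ∀ A, SwapsTypeAt φ A := by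
  by_cases h : ∃ A, PreservesTypeAt φ A
  · obtain ⟨A, hA⟩ := h
    refine Or.inl fun B => ?_
    obtain ⟨C, D, hAC, hCD, hDB⟩ := exists_hyp_eq_of_pts A B
    exact ((hA.of_pt_eq_or_hyp_eq hφ hn (Or.inl hAC)).of_pt_eq_or_hyp_eq hφ hn
      (Or.inr hCD)).of_pt_eq_or_hyp_eq hφ hn (Or.inl hDB)
  · push Not at h
    exact Or.inr fun A => (preservesTypeAt_or_swapsTypeAt hφ hn A).resolve_left (h A)

end AntiFlag

namespace AntiFlag

open Submodule

/-- The conclusion when points go to points: the bijection comes from a semilinear map. -/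
theorem exists_semilinear_of_preservesType (hn : 3 ≤ n) (φ : AntiFlag F n ≃ AntiFlag F n)
    (hpt : ∀ A B, (φ A).pt = (φ B).pt ↔ A.pt = B.pt)
    (hhyp : ∀ A B, (φ A).hyp = (φ B).hyp ↔ A.hyp = B.hyp) :
    ∃ σ : F ≃+* F, ∃ g : (Fin n → F) → (Fin n → F), Function.Bijective g ∧
      (∀ x y, g (x + y) = g x + g y) ∧ (∀ (a : F) x, g (a • x) = σ a • g x) ∧
      ∀ A : AntiFlag F n,
        ((φ A).pt : Set (Fin n → F)) = g '' (A.pt : Set (Fin n → F)) ∧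
        ((φ A).hyp : Set (Fin n → F)) = g '' (A.hyp : Set (Fin n → F)) := by
  have inc : ∀ A B, A.pt ≤ B.hyp ↔ (φ A).pt ≤ (φ B).hyp := by
    intro A B
    rw [← not_iff_not, not_pt_le_hyp_iff, not_pt_le_hyp_iff]
    refine Iff.trans ?_ φ.surjective.exists.symm
    simp only [hpt, hhyp]
  choose v ζ hvζ hv hζ using exists_eq_span_ker (F := F) (n := n)
  have flag : ∀ x : Fin n → F, ∃ y, (x = 0 → y = 0) ∧
      (x ≠ 0 → y ≠ 0 ∧ ∃ A : AntiFlag F n, A.pt = span F {x} ∧ (φ A).pt = span F {y}) := by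
    intro x
    by_cases hx : x = 0
    · exact ⟨0, fun _ => rfl, fun h => absurd hx h⟩
    · obtain ⟨A, hA⟩ := exists_pt_eq hx
      exact ⟨v (φ A), fun h => absurd h hx, fun _ =>
        ⟨fun h => hvζ (φ A) (by rw [h, map_zero]), A, hA, hv _⟩⟩
  choose f hf₀ hf using flag
  have mem_hyp : ∀ x B, x ∈ B.hyp ↔ f x ∈ (φ B).hyp := by
    intro x B
    by_cases hx : x = 0
    · simp [hx, hf₀]
    obtain ⟨-, A, hA, hA'⟩ := hf x hx
    rw [← span_singleton_le_iff_mem, ← hA, inc, hA', span_singleton_le_iff_mem]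
  have mem_pt : ∀ x B, x ∈ B.pt ↔ f x ∈ (φ B).pt := by
    intro x B
    by_cases hx : x = 0
    · simp [hx, hf₀]
    obtain ⟨hfx, A, hA, hA'⟩ := hf x hx
    rw [mem_pt_iff hx, mem_pt_iff hfx, ← hA, ← hA', hpt]
  obtain ⟨σ, g, hg, hadd, hsmul, hfg⟩ := exists_semilinear_of_map_hyperplanes hn
    (Module.finrank_fin_fun F) f (hf₀ 0 rfl)
    (fun ξ => by
      by_cases hξ : ξ = 0
      · exact ⟨0, by simp [hξ]⟩
      obtain ⟨B, hB⟩ := exists_hyp_eq hξ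
      refine ⟨ζ (φ B), fun x => ?_⟩
      rw [← LinearMap.mem_ker, ← LinearMap.mem_ker, ← hB, ← hζ, mem_hyp])
    (fun y => by
      by_cases hy : y = 0
      · exact ⟨0, 0, by simp [hy]⟩
      obtain ⟨A, hA⟩ := exists_pt_eq hy
      obtain ⟨B, rfl⟩ := φ.surjective A
      have hvB : v B ≠ 0 := fun h => hvζ B (by rw [h, map_zero])
      have h := (mem_pt (v B) B).1 (by rw [hv B]; exact mem_span_singleton_self _)
      rw [mem_pt_iff (hf _ hvB).1] at h
      have hy' : y ∈ span F {f (v B)} := by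
        rw [← h, hA]
        exact mem_span_singleton_self _
      obtain ⟨c, hc⟩ := mem_span_singleton.1 hy'
      exact ⟨v B, c, hc.symm⟩)
  have image_eq : ∀ P Q : Submodule F (Fin n → F), (∀ x, x ∈ P ↔ f x ∈ Q) →
      (Q : Set (Fin n → F)) = g '' P := by
    intro P Q h
    rw [← Set.image_preimage_eq (Q : Set (Fin n → F)) hg.2]
    congr 1
    ext x
    obtain ⟨c, hc, hx⟩ := hfg x
    rw [Set.mem_preimage, SetLike.mem_coe, SetLike.mem_coe, h, hx, Q.smul_mem_iff hc]
  exact ⟨σ, g, hg, hadd, hsmul, fun A =>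
    ⟨image_eq _ _ fun x => mem_pt x A, image_eq _ _ fun x => mem_hyp x A⟩⟩

/-- The conclusion when points go to hyperplanes: the bijection comes from a semilinear map to the
dual space. -/
theorem exists_semilinear_of_swapsType (hn : 3 ≤ n) (φ : AntiFlag F n ≃ AntiFlag F n)
    (hpt : ∀ A B, (φ A).hyp = (φ B).hyp ↔ A.pt = B.pt)
    (hhyp : ∀ A B, (φ A).pt = (φ B).pt ↔ A.hyp = B.hyp) :
    ∃ σ : F ≃+* F, ∃ u : (Fin n → F) → ((Fin n → F) →ₗ[F] F), Function.Bijective u ∧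
      (∀ x y, u (x + y) = u x + u y) ∧ (∀ (a : F) x, u (a • x) = σ a • u x) ∧
      ∀ A : AntiFlag F n,
        ((φ A).pt : Set (Fin n → F)) = {x : Fin n → F | ∀ y ∈ A.hyp, u y x = 0} ∧
        ((φ A).hyp : Set (Fin n → F)) = {x : Fin n → F | ∀ y ∈ A.pt, u y x = 0} := by
  have inc : ∀ A B, A.pt ≤ B.hyp ↔ (φ B).pt ≤ (φ A).hyp := by
    intro A B
    rw [← not_iff_not, not_pt_le_hyp_iff, not_pt_le_hyp_iff]
    refine Iff.trans ?_ φ.surjective.exists.symm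
    simp only [hpt, hhyp, and_comm]
  choose v ζ hvζ hv hζ using exists_eq_span_ker (F := F) (n := n)
  have hv₀ : ∀ A, v A ≠ 0 := fun A h => hvζ A (by rw [h, map_zero])
  have v_mem : ∀ A, v A ∈ A.pt := fun A => (mem_pt_iff (hv₀ A)).2 (hv A)
  have flag : ∀ x : Fin n → F, ∃ η : Module.Dual F (Fin n → F), (x = 0 → η = 0) ∧
      (x ≠ 0 → ∃ A : AntiFlag F n, A.pt = span F {x} ∧ (φ A).hyp = LinearMap.ker η) := by
    intro x
    by_cases hx : x = 0
    · exact ⟨0, fun _ => rfl, fun h => absurd hx h⟩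
    · obtain ⟨A, hA⟩ := exists_pt_eq hx
      exact ⟨ζ (φ A), fun h => absurd h hx, fun _ => ⟨A, hA, hζ _⟩⟩
  choose f hf₀ hf using flag
  have mem_hyp : ∀ x B, x ∈ B.hyp ↔ (φ B).pt ≤ LinearMap.ker (f x) := by
    intro x B
    by_cases hx : x = 0
    · simp [hx, hf₀]
    obtain ⟨A, hA, hA'⟩ := hf x hx
    rw [← span_singleton_le_iff_mem, ← hA, inc, hA']
  have mem_pt : ∀ x B, x ≠ 0 → x ∈ B.pt → (φ B).hyp = LinearMap.ker (f x) := by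
    intro x B hx hxB
    obtain ⟨A, hA, hA'⟩ := hf x hx
    rw [← hA', hpt, hA, (mem_pt_iff hx).1 hxB]
  obtain ⟨σ, u, hu, hadd, hsmul, hfu⟩ := exists_semilinear_of_map_hyperplanes hn
    (W := Module.Dual F (Fin n → F)) (by rw [Subspace.dual_finrank_eq, Module.finrank_fin_fun])
    f (hf₀ 0 rfl)
    (fun ξ => by
      by_cases hξ : ξ = 0
      · exact ⟨0, by simp [hξ]⟩
      obtain ⟨B, hB⟩ := exists_hyp_eq hξ
      refine ⟨Module.Dual.eval F _ (v (φ B)), fun x => ?_⟩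
      rw [← LinearMap.mem_ker, ← hB, mem_hyp, hv, span_singleton_le_iff_mem, LinearMap.mem_ker,
        Module.Dual.eval_apply])
    (fun η => by
      by_cases hη : η = 0
      · exact ⟨0, 0, by simp [hη]⟩
      obtain ⟨A, hA⟩ := exists_hyp_eq hη
      obtain ⟨B, rfl⟩ := φ.surjective A
      have h := mem_pt (v B) B (hv₀ B) (v_mem B)
      have hmem : η ∈ span F (Set.range fun _ : Unit => f (v B)) :=
        mem_span_of_iInf_ker_le_ker (by simp [← h, hA])
      rw [Set.range_const] at hmem
      obtain ⟨c, hc⟩ := mem_span_singleton.1 hmem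
      exact ⟨v B, c, hc.symm⟩)
  have ker_eq : ∀ x, LinearMap.ker (f x) = LinearMap.ker (u x) := by
    intro x
    obtain ⟨c, hc, hx⟩ := hfu x
    rw [hx, LinearMap.ker_smul _ _ hc]
  simp only [ker_eq] at mem_hyp mem_pt
  refine ⟨σ, u, hu, hadd, hsmul, fun A => ⟨Set.ext fun z => ⟨fun hz y hy => ?_, fun hz => ?_⟩,
    Set.ext fun z => ⟨fun hz y hy => ?_, fun hz => ?_⟩⟩⟩
  · exact (mem_hyp y A).1 hy hz
  · by_cases hz₀ : z = 0
    · rw [hz₀]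
      exact zero_mem _
    obtain ⟨C, hC⟩ := exists_pt_eq hz₀
    obtain ⟨B, rfl⟩ := φ.surjective C
    have hle : A.hyp ≤ B.hyp := fun y hy => by
      rw [mem_hyp, hC, span_singleton_le_iff_mem]
      exact hz y hy
    rw [SetLike.mem_coe, (hhyp A B).2 (hyp_eq_of_le hle), hC]
    exact mem_span_singleton_self z
  · by_cases hy₀ : y = 0
    · rw [hy₀, show u 0 = 0 by simpa using hadd 0 0, LinearMap.zero_apply]
    · have h := mem_pt y A hy₀ hy
      rw [SetLike.mem_coe, h] at hz
      exact hz
  · rw [SetLike.mem_coe, mem_pt (v A) A (hv₀ A) (v_mem A)]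
    exact hz (v A) (v_mem A)

end AntiFlag

theorem stmt18 (hn : 3 ≤ n) (φ : AntiFlag F n ≃ AntiFlag F n)
    (hφ : ∀ A B : AntiFlag F n, adj3 A B ↔ adj3 (φ A) (φ B)) :
    (∃ σ : F ≃+* F, ∃ g : (Fin n → F) → (Fin n → F), Function.Bijective g ∧
      (∀ x y, g (x + y) = g x + g y) ∧ (∀ (a : F) x, g (a • x) = σ a • g x) ∧
      ∀ A : AntiFlag F n,
        ((φ A).pt : Set (Fin n → F)) = g '' (A.pt : Set (Fin n → F)) ∧
        ((φ A).hyp : Set (Fin n → F)) = g '' (A.hyp : Set (Fin n → F))) ∨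
    (∃ σ : F ≃+* F, ∃ u : (Fin n → F) → ((Fin n → F) →ₗ[F] F), Function.Bijective u ∧
      (∀ x y, u (x + y) = u x + u y) ∧ (∀ (a : F) x, u (a • x) = σ a • u x) ∧
      ∀ A : AntiFlag F n,
        ((φ A).pt : Set (Fin n → F)) = {x : Fin n → F | ∀ y ∈ A.hyp, u y x = 0} ∧
        ((φ A).hyp : Set (Fin n → F)) = {x : Fin n → F | ∀ y ∈ A.pt, u y x = 0}) := by
  have reflect : ∀ A B, adj3 (φ A) (φ B) → A.pt = B.pt ∨ A.hyp = B.hyp := fun A B h =>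
    ((hφ A B).2 h).2
  rcases AntiFlag.forall_preservesTypeAt_or_forall_swapsTypeAt hφ hn with h | h
  · refine Or.inl (AntiFlag.exists_semilinear_of_preservesType hn φ
      (fun A B => ⟨fun hAB => ?_, (h A).1 B⟩) (fun A B => ⟨fun hAB => ?_, (h A).2 B⟩))
    · by_cases hne : φ A = φ B
      · rw [φ.injective hne]
      exact (reflect A B ⟨hne, Or.inl hAB⟩).resolve_right fun h' =>
        hne (AntiFlag.eq_of_pt_hyp hAB ((h A).2 B h'))
    · by_cases hne : φ A = φ B
      · rw [φ.injective hne]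
      exact (reflect A B ⟨hne, Or.inr hAB⟩).resolve_left fun h' =>
        hne (AntiFlag.eq_of_pt_hyp ((h A).1 B h') hAB)
  · refine Or.inr (AntiFlag.exists_semilinear_of_swapsType hn φ
      (fun A B => ⟨fun hAB => ?_, (h A).1 B⟩) (fun A B => ⟨fun hAB => ?_, (h A).2 B⟩))
    · by_cases hne : φ A = φ B
      · rw [φ.injective hne]
      exact (reflect A B ⟨hne, Or.inr hAB⟩).resolve_right fun h' =>
        hne (AntiFlag.eq_of_pt_hyp ((h A).2 B h') hAB)
    · by_cases hne : φ A = φ B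
      · rw [φ.injective hne]
      exact (reflect A B ⟨hne, Or.inl hAB⟩).resolve_left fun h' =>
        hne (AntiFlag.eq_of_pt_hyp hAB ((h A).1 B h'))
end

section
/- Let φ be a bijection of the set of nonsingular vectors of W such that for all distinct nonsingular vectors z_1, z_2: Q(z_1 + z_2) = 1 if and only if Q(φ(z_1) + φ(z_2)) = 1. Then there exists a linear automorphism g of W with Q(g(w)) = Q(w) for all w ∈ W such that φ(z) = g(z) for every nonsingular vector z. -/
/-- The 2n-dimensional vector space `W = V × V*` over the field with two elements. -/
abbrev Wsp (n : ℕ) := (Fin n → ZMod 2) × ((Fin n → ZMod 2) →ₗ[ZMod 2] ZMod 2)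

/-- The hyperbolic quadratic form `Q(x, x^*) = x^*(x)` on `W`. -/
def Qf {n : ℕ} (v : Wsp n) : ZMod 2 := v.2 v.1

/-- The polarization of `Qf`. -/
def polarForm (n : ℕ) : Wsp n →ₗ[ZMod 2] Wsp n →ₗ[ZMod 2] ZMod 2 :=
  LinearMap.mk₂ (ZMod 2) (fun v w => v.2 w.1 + w.2 v.1)
    (by intros; simp; ring) (by intros; simp; ring) (by intros; simp; ring)
    (by intros; simp; ring)

theorem polarForm_apply {n : ℕ} (v w : Wsp n) : polarForm n v w = v.2 w.1 + w.2 v.1 := rfl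

theorem Qf_add {n : ℕ} (v w : Wsp n) : Qf (v + w) = Qf v + Qf w + polarForm n v w := by
  simp [Qf, polarForm_apply]
  ring

theorem polarForm_self {n : ℕ} (v : Wsp n) : polarForm n v v = 0 :=
  CharTwo.add_self_eq_zero _

theorem eq_zero_of_polarForm_eq_zero {n : ℕ} {v : Wsp n} (h : ∀ w, polarForm n v w = 0) :
    v = 0 := by
  refine Prod.ext (funext fun i => ?_) (LinearMap.ext fun y => ?_)
  · simpa [polarForm_apply] using h (0, LinearMap.proj i)
  · simpa [polarForm_apply] using h (y, 0)

theorem span_nonsingular_eq_top {n : ℕ} (hn : 2 ≤ n) :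
    Submodule.span (ZMod 2) {z : Wsp n | Qf z = 1} = ⊤ := by
  have dual_mem : ∀ x : Fin n → ZMod 2, x ≠ 0 → ∃ f : (Fin n → ZMod 2) →ₗ[ZMod 2] ZMod 2,
      f x = 1 := by
    intro x hx
    obtain ⟨i, hi⟩ := Function.ne_iff.mp hx
    exact ⟨LinearMap.proj i, Fin.eq_one_of_ne_zero (x i) hi⟩
  have snd_mem : ∀ h, ((0, h) : Wsp n) ∈ Submodule.span (ZMod 2) {z : Wsp n | Qf z = 1} := by
    intro h
    obtain ⟨x, hx, hx0⟩ := (Submodule.ne_bot_iff _).mp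
      (LinearMap.ker_ne_bot_of_finrank_lt (f := h) (by simp; omega))
    obtain ⟨f, hf⟩ := dual_mem x hx0
    have h₁ : ((x, f + h) : Wsp n) ∈ {z : Wsp n | Qf z = 1} := by
      simp [Qf, hf, LinearMap.mem_ker.mp hx]
    have h₂ : ((x, f) : Wsp n) ∈ {z : Wsp n | Qf z = 1} := hf
    have := Submodule.sub_mem _ (Submodule.subset_span (R := ZMod 2) h₁)
      (Submodule.subset_span h₂)
    simpa using this
  refine Submodule.eq_top_iff'.mpr fun ⟨x, g⟩ => ?_
  by_cases hx : x = 0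
  · exact hx ▸ snd_mem g
  obtain ⟨f, hf⟩ := dual_mem x hx
  have h₂ : ((x, f) : Wsp n) ∈ {z : Wsp n | Qf z = 1} := hf
  have := Submodule.add_mem _ (Submodule.subset_span (R := ZMod 2) h₂) (snd_mem (g - f))
  simpa using this

theorem ZMod.two_eq_of_one_iff {a b : ZMod 2} (h : a = 1 ↔ b = 1) : a = b := by
  revert a b
  decide

/-- Polarization-preserving bijections of the nonsingular vectors extend to isometries. -/
theorem exists_isometry_of_polarForm_eq {n : ℕ} (hn : 2 ≤ n)
    (φ : {z : Wsp n // Qf z = 1} ≃ {z : Wsp n // Qf z = 1})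
    (hφ : ∀ z w, polarForm n (φ z : Wsp n) (φ w : Wsp n) = polarForm n (z : Wsp n) (w : Wsp n)) :
    ∃ g : Wsp n →ₗ[ZMod 2] Wsp n, Function.Bijective g ∧
      (∀ w : Wsp n, Qf (g w) = Qf w) ∧
      ∀ z : {z : Wsp n // Qf z = 1}, (φ z : Wsp n) = g (z : Wsp n) := by
  let L := Finsupp.linearCombination (ZMod 2)
    (fun z : {z : Wsp n // Qf z = 1} => (z : Wsp n))
  let M := Finsupp.linearCombination (ZMod 2)
    (fun z : {z : Wsp n // Qf z = 1} => (φ z : Wsp n))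
  have L_range : LinearMap.range L = ⊤ := by
    rw [Finsupp.range_linearCombination, Subtype.range_coe_subtype]
    exact span_nonsingular_eq_top hn
  have M_range : LinearMap.range M = ⊤ := by
    rw [Finsupp.range_linearCombination]
    have : Set.range (fun z : {z : Wsp n // Qf z = 1} => (φ z : Wsp n)) = {z | Qf z = 1} := by
      rw [← Subtype.range_coe_subtype]
      exact φ.surjective.range_comp Subtype.val
    rw [this]
    exact span_nonsingular_eq_top hn
  have polar : (polarForm n).compl₁₂ M M = (polarForm n).compl₁₂ L L := by
    ext z w
    simpa [L, M] using hφ z w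
  replace polar : ∀ c d, polarForm n (M c) (M d) = polarForm n (L c) (L d) :=
    fun c d => LinearMap.congr_fun₂ polar c d
  have ker_le : ∀ c, L c = 0 → M c = 0 := by
    intro c hc
    refine eq_zero_of_polarForm_eq_zero fun w => ?_
    obtain ⟨d, rfl⟩ := LinearMap.range_eq_top.mp M_range w
    simp [polar, hc]
  obtain ⟨s, hs⟩ := L.exists_rightInverse_of_surjective L_range
  have g_apply : ∀ c, (M ∘ₗ s) (L c) = M c := by
    intro c
    have h := ker_le (s (L c) - c) (by
      rw [map_sub, sub_eq_zero]
      exact LinearMap.congr_fun hs (L c))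
    rwa [map_sub, sub_eq_zero] at h
  have g_polar : ∀ v w, polarForm n ((M ∘ₗ s) v) ((M ∘ₗ s) w) = polarForm n v w := by
    intro v w
    obtain ⟨c, rfl⟩ := LinearMap.range_eq_top.mp L_range v
    obtain ⟨d, rfl⟩ := LinearMap.range_eq_top.mp L_range w
    rw [g_apply, g_apply, polar]
  have g_eq : ∀ z : {z : Wsp n // Qf z = 1}, (φ z : Wsp n) = (M ∘ₗ s) (z : Wsp n) := by
    intro z
    simpa [L, M] using (g_apply (Finsupp.single z 1)).symm
  have g_surj : Function.Surjective (M ∘ₗ s) := by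
    intro w
    obtain ⟨d, rfl⟩ := LinearMap.range_eq_top.mp M_range w
    exact ⟨L d, g_apply d⟩
  refine ⟨M ∘ₗ s, ⟨LinearMap.injective_iff_surjective.mpr g_surj, g_surj⟩, fun w => ?_, g_eq⟩
  have hw : w ∈ Submodule.span (ZMod 2) {z : Wsp n | Qf z = 1} := by
    rw [span_nonsingular_eq_top hn]
    trivial
  induction hw using Submodule.span_induction with
  | mem z hz =>
    rw [← g_eq ⟨z, hz⟩, (φ ⟨z, hz⟩).2]
    exact hz.symm
  | zero => rw [map_zero]
  | add v w _ _ hv hw => rw [map_add, Qf_add, Qf_add, hv, hw, g_polar]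
  | smul a v _ hv =>
    rw [map_smul]
    simp only [Qf, Prod.smul_fst, Prod.smul_snd, LinearMap.smul_apply, map_smul] at hv ⊢
    rw [hv]

theorem stmt19 {n : ℕ} (hn : 3 ≤ n)
    (φ : {z : Wsp n // Qf z = 1} ≃ {z : Wsp n // Qf z = 1})
    (hφ : ∀ z1 z2 : {z : Wsp n // Qf z = 1}, z1 ≠ z2 →
      (Qf ((z1 : Wsp n) + (z2 : Wsp n)) = 1 ↔
        Qf ((φ z1 : Wsp n) + (φ z2 : Wsp n)) = 1)) :
    ∃ g : Wsp n →ₗ[ZMod 2] Wsp n, Function.Bijective g ∧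
      (∀ w : Wsp n, Qf (g w) = Qf w) ∧
      ∀ z : {z : Wsp n // Qf z = 1}, (φ z : Wsp n) = g (z : Wsp n) := by
  refine exists_isometry_of_polarForm_eq (by omega) φ fun z w => ?_
  by_cases h : z = w
  · rw [h, polarForm_self, polarForm_self]
  · have := ZMod.two_eq_of_one_iff (hφ z w h)
    rw [Qf_add, Qf_add, z.2, w.2, (φ z).2, (φ w).2] at this
    exact (add_left_cancel this).symm
end
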